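/- Let τ be a unit-trace Hermitian operator and σ a positive semidefinite operator on a finite-dimensional Hilbert space. For all ε ∈ [0,1) and α ∈ (1,∞), the extended hypothesis-testing divergence satisfies D_H^ε(τ∥σ) ≤ D̃_α(τ∥σ) + (α/(α−1)) ln(1/(1−ε)). -/

import Mathlib

open scoped Kronecker
open Matrix Filter Topology
open scoped ComplexOrder
attribute [local instance] Classical.propDecidable

namespace QHE

/-- Functional calculus for Hermitian matrices (junk value `0` on non-Hermitian input). -/
noncomputable def mfun {n : Type*} [Fintype n] [DecidableEq n] (f : ℝ → ℝ)
    (A : Matrix n n ℂ) : Matrix n n ℂ :=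
  if hA : A.IsHermitian then
    (hA.eigenvectorUnitary : Matrix n n ℂ) *
      Matrix.diagonal (fun i => (f (hA.eigenvalues i) : ℂ)) *
      (star (hA.eigenvectorUnitary : Matrix n n ℂ))
  else 0

/-- Real power of a Hermitian matrix, taken on its support (`0 ^ r = 0`). -/
noncomputable def mpow {n : Type*} [Fintype n] [DecidableEq n] (A : Matrix n n ℂ) (r : ℝ) :
    Matrix n n ℂ :=
  mfun (fun x => if x = 0 then 0 else Real.rpow x r) A

/-- Logarithm of a Hermitian matrix, taken on its support. -/
noncomputable def mlog {n : Type*} [Fintype n] [DecidableEq n] (A : Matrix n n ℂ) :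
    Matrix n n ℂ :=
  mfun (fun x => if x = 0 then 0 else Real.log x) A

/-- `‖X‖_α ^ α = Tr[(Xᴴ X)^(α/2)]`, the α-th power of the Schatten α-norm. -/
noncomputable def schattenPow {n : Type*} [Fintype n] [DecidableEq n] (α : ℝ)
    (X : Matrix n n ℂ) : ℝ :=
  ((mpow (Xᴴ * X) (α / 2)).trace).re

/-- Support inclusion `supp γ ⊆ supp σ`, phrased as kernel inclusion `ker σ ⊆ ker γ`. -/
noncomputable def suppLE {n : Type*} [Fintype n] (γ σ : Matrix n n ℂ) : Prop :=
  ∀ v : n → ℂ, σ.mulVec v = 0 → γ.mulVec v = 0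

/-- Extended sandwiched Rényi quasi-divergence
`Q̃_α(γ∥σ) = ‖σ^((1-α)/(2α)) γ σ^((1-α)/(2α))‖_α^α`. -/
noncomputable def sandQ {n : Type*} [Fintype n] [DecidableEq n] (α : ℝ)
    (γ σ : Matrix n n ℂ) : ℝ :=
  schattenPow α (mpow σ ((1 - α) / (2 * α)) * γ * mpow σ ((1 - α) / (2 * α)))

/-- Extended sandwiched Rényi divergence (real-valued formula, meaningful when
`supp γ ⊆ supp σ`). -/
noncomputable def sandDR {n : Type*} [Fintype n] [DecidableEq n] (α : ℝ)
    (γ σ : Matrix n n ℂ) : ℝ :=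
  (1 / (α - 1)) * Real.log (sandQ α γ σ)

/-- Extended sandwiched Rényi divergence, `+∞` when the support condition fails. -/
noncomputable def sandD {n : Type*} [Fintype n] [DecidableEq n] (α : ℝ)
    (γ σ : Matrix n n ℂ) : EReal :=
  if suppLE γ σ then ((sandDR α γ σ : ℝ) : EReal) else ⊤

/-- Trace norm `‖X‖₁`. -/
noncomputable def traceNorm {n : Type*} [Fintype n] [DecidableEq n] (X : Matrix n n ℂ) : ℝ :=
  schattenPow 1 X

/-- Absolute value `|X| = (Xᴴ X)^(1/2)`. -/
noncomputable def matAbs {n : Type*} [Fintype n] [DecidableEq n] (X : Matrix n n ℂ) :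
    Matrix n n ℂ :=
  mpow (Xᴴ * X) (1 / 2 : ℝ)

/-- Umegaki relative entropy `Tr[ρ(ln ρ − ln σ)]` (real-valued formula). -/
noncomputable def umegakiR {n : Type*} [Fintype n] [DecidableEq n] (ρ σ : Matrix n n ℂ) : ℝ :=
  ((ρ * (mlog ρ - mlog σ)).trace).re

/-- Umegaki relative entropy, `+∞` when the support condition fails. -/
noncomputable def umegaki {n : Type*} [Fintype n] [DecidableEq n] (ρ σ : Matrix n n ℂ) : EReal :=
  if suppLE ρ σ then ((umegakiR ρ σ : ℝ) : EReal) else ⊤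

/-- Density operator: positive semidefinite with unit trace. -/
noncomputable def IsState {n : Type*} [Fintype n] (ρ : Matrix n n ℂ) : Prop :=
  ρ.PosSemidef ∧ ρ.trace = 1

/-- Unit-trace Hermitian operator. -/
def UnitTraceHerm {n : Type*} [Fintype n] (τ : Matrix n n ℂ) : Prop :=
  τ.IsHermitian ∧ τ.trace = 1

/-- `−ln x`, valued `+∞` for `x ≤ 0`. -/
noncomputable def negLogE (x : ℝ) : EReal :=
  if x ≤ 0 then ⊤ else ((-Real.log x : ℝ) : EReal)

/-- Extended hypothesis-testing divergence
`D_H^ε(τ∥σ) = sup{−ln Tr[Λσ] : 0 ≤ Λ ≤ I, Tr[Λτ] ≥ 1−ε}`. -/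
noncomputable def DH {n : Type*} [Fintype n] [DecidableEq n] (ε : ℝ)
    (τ σ : Matrix n n ℂ) : EReal :=
  ⨆ Λ ∈ {Λ : Matrix n n ℂ |
      Λ.PosSemidef ∧ (1 - Λ).PosSemidef ∧ 1 - ε ≤ ((Λ * τ).trace).re},
    negLogE (((Λ * σ).trace).re)

/-- Optimal error probability of state exclusion for the ensemble `(p, ρ)`. -/
noncomputable def Perr {n ι : Type*} [Fintype n] [DecidableEq n] [Fintype ι]
    (p : ι → ℝ) (ρ : ι → Matrix n n ℂ) : ℝ :=
  sInf {e : ℝ | ∃ Λ : ι → Matrix n n ℂ, (∀ x, (Λ x).PosSemidef) ∧ (∑ x, Λ x = 1) ∧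
    e = ∑ x, p x * (((Λ x) * (ρ x)).trace).re}

/-- Optimal success probability of state discrimination for the ensemble `(p, ρ)`. -/
noncomputable def Psucc {n ι : Type*} [Fintype n] [DecidableEq n] [Fintype ι]
    (p : ι → ℝ) (ρ : ι → Matrix n n ℂ) : ℝ :=
  sSup {e : ℝ | ∃ Λ : ι → Matrix n n ℂ, (∀ x, (Λ x).PosSemidef) ∧ (∑ x, Λ x = 1) ∧
    e = ∑ x, p x * (((Λ x) * (ρ x)).trace).re}

/-- The probability simplex over a finite index type. -/
def probSimplex (ι : Type*) [Fintype ι] : Set (ι → ℝ) :=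
  {s | (∀ x, 0 ≤ s x) ∧ ∑ x, s x = 1}

/-- CPTP maps, characterized by Kraus representations. -/
def IsCPTP {n m : Type*} [Fintype n] [DecidableEq n] [Fintype m] [DecidableEq m]
    (Φ : Matrix n n ℂ → Matrix m m ℂ) : Prop :=
  ∃ (k : ℕ) (K : Fin k → Matrix m n ℂ), (∑ i, (K i)ᴴ * K i = 1) ∧
    ∀ A, Φ A = ∑ i, K i * A * (K i)ᴴ

/-- Completely positive maps, characterized by Kraus representations. -/
def IsCPMap {n m : Type*} [Fintype n] [DecidableEq n] [Fintype m] [DecidableEq m]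
    (Φ : Matrix n n ℂ → Matrix m m ℂ) : Prop :=
  ∃ (k : ℕ) (K : Fin k → Matrix m n ℂ), ∀ A, Φ A = ∑ i, K i * A * (K i)ᴴ

/-- Extension `id_{C^d} ⊗ Φ` of a (linear) map `Φ` to a `d`-dimensional reference system. -/
noncomputable def matExt {n m : Type*} (Φ : Matrix n n ℂ → Matrix m m ℂ) (d : ℕ)
    (X : Matrix (Fin d × n) (Fin d × n) ℂ) : Matrix (Fin d × m) (Fin d × m) ℂ :=
  Matrix.of fun p q => Φ (Matrix.of fun a b => X (p.1, a) (q.1, b)) p.2 q.2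

/-- Partial trace over the first tensor factor. -/
noncomputable def ptraceFst {a b : Type*} [Fintype a] (X : Matrix (a × b) (a × b) ℂ) : Matrix b b ℂ :=
  Matrix.of fun i j => ∑ k : a, X (k, i) (k, j)

/-- `k`-fold tensor power `A^{⊗k}` of a matrix. -/
noncomputable def tensPow {n : Type*} [Fintype n] (A : Matrix n n ℂ) (k : ℕ) :
    Matrix (Fin k → n) (Fin k → n) ℂ :=
  Matrix.of fun f g => ∏ i, A (f i) (g i)

/-- Max-divergence `D_max(ρ∥σ) = inf{ln λ : λ ≥ 0, ρ ≤ λσ}` (`+∞` if infeasible). -/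
noncomputable def Dmax {n : Type*} [Fintype n] [DecidableEq n] (ρ σ : Matrix n n ℂ) : EReal :=
  ⨅ l ∈ {l : ℝ | 0 ≤ l ∧ (l • σ - ρ).PosSemidef}, ((Real.log l : ℝ) : EReal)

/-- Channel divergence induced by a family of state divergences `D`:
supremum over reference dimensions and bipartite input states. -/
noncomputable def Dch
    (D : (k : Type) → [Fintype k] → [DecidableEq k] → Matrix k k ℂ → Matrix k k ℂ → EReal)
    {n m : Type} [Fintype n] [DecidableEq n] [Fintype m] [DecidableEq m]
    (N M : Matrix n n ℂ → Matrix m m ℂ) : EReal :=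
  ⨆ (d : ℕ), ⨆ ρ ∈ {ρ : Matrix (Fin d × n) (Fin d × n) ℂ | IsState ρ},
    D (Fin d × m) (matExt N d ρ) (matExt M d ρ)


section FunctionalCalculus

variable {n : Type*} [Fintype n] [DecidableEq n] {A : Matrix n n ℂ}

lemma mfun_of_isHermitian (hA : A.IsHermitian) (f : ℝ → ℝ) :
    mfun f A = (hA.eigenvectorUnitary : Matrix n n ℂ) *
      diagonal (fun i => (f (hA.eigenvalues i) : ℂ)) *
      (hA.eigenvectorUnitary : Matrix n n ℂ)ᴴ := by
  rw [mfun, dif_pos hA, star_eq_conjTranspose]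

lemma conjTranspose_eigenvectorUnitary_mul_self (hA : A.IsHermitian) :
    (hA.eigenvectorUnitary : Matrix n n ℂ)ᴴ * (hA.eigenvectorUnitary : Matrix n n ℂ) = 1 :=
  Unitary.star_mul_self_of_mem hA.eigenvectorUnitary.2

lemma eigenvectorUnitary_mul_conjTranspose_self (hA : A.IsHermitian) :
    (hA.eigenvectorUnitary : Matrix n n ℂ) * (hA.eigenvectorUnitary : Matrix n n ℂ)ᴴ = 1 :=
  Unitary.mul_star_self_of_mem hA.eigenvectorUnitary.2

lemma mfun_id (hA : A.IsHermitian) : mfun (fun x => x) A = A := by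
  rw [mfun_of_isHermitian hA]
  conv_rhs => rw [hA.spectral_theorem, Unitary.conjStarAlgAut_apply]
  rfl

lemma mfun_const_one (hA : A.IsHermitian) : mfun (fun _ => 1) A = 1 := by
  rw [mfun_of_isHermitian hA]
  simp [eigenvectorUnitary_mul_conjTranspose_self hA]

lemma mfun_congr (hA : A.IsHermitian) {f g : ℝ → ℝ}
    (h : ∀ i, f (hA.eigenvalues i) = g (hA.eigenvalues i)) : mfun f A = mfun g A := by
  rw [mfun_of_isHermitian hA, mfun_of_isHermitian hA]
  simp only [h]

lemma mfun_mul (hA : A.IsHermitian) (f g : ℝ → ℝ) :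
    mfun f A * mfun g A = mfun (fun x => f x * g x) A := by
  simp only [mfun_of_isHermitian hA]
  set V := (hA.eigenvectorUnitary : Matrix n n ℂ)
  have hVV : Vᴴ * V = 1 := conjTranspose_eigenvectorUnitary_mul_self hA
  calc _ = V * diagonal (fun i => (f (hA.eigenvalues i) : ℂ)) * (Vᴴ * V) *
        diagonal (fun i => (g (hA.eigenvalues i) : ℂ)) * Vᴴ := by simp only [Matrix.mul_assoc]
    _ = _ := by
      rw [hVV, Matrix.mul_one, Matrix.mul_assoc V, diagonal_mul_diagonal]
      simp only [Complex.ofReal_mul]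

lemma mfun_isHermitian (f : ℝ → ℝ) (A : Matrix n n ℂ) : (mfun f A).IsHermitian := by
  by_cases hA : A.IsHermitian
  · rw [mfun_of_isHermitian hA]
    refine isHermitian_mul_mul_conjTranspose _ (isHermitian_diagonal_of_self_adjoint _ ?_)
    ext i
    simp
  · rw [mfun, dif_neg hA]
    exact isHermitian_zero

/-- The trace of `mfun f A` only depends on the characteristic polynomial of `A`. -/
lemma trace_mfun_of_charpoly_eq (hA : A.IsHermitian) (f : ℝ → ℝ) (d : n → ℝ)
    (h : A.charpoly = (diagonal (fun i => (d i : ℂ))).charpoly) :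
    (mfun f A).trace.re = ∑ i, f (d i) := by
  have hroots : A.charpoly.roots = Multiset.map (fun i => (d i : ℂ)) Finset.univ.val := by
    rw [h, charpoly_diagonal, Polynomial.roots_prod]
    · simp
    · simp [Finset.prod_ne_zero_iff, Polynomial.X_sub_C_ne_zero]
  rw [hA.roots_charpoly_eq_eigenvalues] at hroots
  have hsum := congrArg (fun s => (Multiset.map (fun z : ℂ => f z.re) s).sum) hroots
  simp only [Multiset.map_map, Function.comp_apply, Complex.coe_algebraMap,
    Complex.ofReal_re] at hsum
  rw [mfun_of_isHermitian hA, trace_mul_comm, ← Matrix.mul_assoc,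
    conjTranspose_eigenvectorUnitary_mul_self, Matrix.one_mul, trace_diagonal]
  simpa using hsum

lemma charpoly_eq_diagonal_eigenvalues (hA : A.IsHermitian) :
    A.charpoly = (diagonal (fun i => (hA.eigenvalues i : ℂ))).charpoly := by
  rw [hA.charpoly_eq, charpoly_diagonal]
  rfl

lemma trace_mfun (hA : A.IsHermitian) (f : ℝ → ℝ) :
    (mfun f A).trace.re = ∑ i, f (hA.eigenvalues i) :=
  trace_mfun_of_charpoly_eq hA f _ (charpoly_eq_diagonal_eigenvalues hA)

lemma trace_mfun_conjTranspose_mul_self (f : ℝ → ℝ) (M : Matrix n n ℂ) :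
    (mfun f (Mᴴ * M)).trace.re = (mfun f (M * Mᴴ)).trace.re := by
  rw [trace_mfun (isHermitian_mul_conjTranspose_self M)]
  refine trace_mfun_of_charpoly_eq (isHermitian_conjTranspose_mul_self M) f _ ?_
  rw [charpoly_mul_comm]
  exact charpoly_eq_diagonal_eigenvalues _

lemma schattenPow_of_isHermitian {α : ℝ} (hα : 0 < α) (hA : A.IsHermitian) :
    schattenPow α A = ∑ i, |hA.eigenvalues i| ^ α := by
  have hsq : Aᴴ * A = mfun (fun x => x * x) A := by
    rw [← mfun_mul hA (fun x => x) (fun x => x), mfun_id hA, hA.eq]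
  have hch : (Aᴴ * A).charpoly =
      (diagonal (fun i => ((hA.eigenvalues i * hA.eigenvalues i : ℝ) : ℂ))).charpoly := by
    rw [hsq, mfun_of_isHermitian hA, charpoly_mul_comm, ← Matrix.mul_assoc,
      conjTranspose_eigenvectorUnitary_mul_self, Matrix.one_mul]
  rw [schattenPow, mpow, trace_mfun_of_charpoly_eq (isHermitian_conjTranspose_mul_self A) _ _ hch]
  refine Finset.sum_congr rfl fun i _ => ?_
  by_cases h0 : hA.eigenvalues i = 0
  · simp [h0, Real.zero_rpow hα.ne']
  · rw [if_neg (mul_self_ne_zero.mpr h0), Real.rpow_eq_pow, ← abs_mul_abs_self,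
      ← sq, ← Real.rpow_natCast, ← Real.rpow_mul (abs_nonneg _)]
    congr 1
    push_cast
    ring

lemma conj_mfun_apply_re (hA : A.IsHermitian) (f : ℝ → ℝ) (C : Matrix n n ℂ) (i : n) :
    ((Cᴴ * mfun f A * C) i i).re = ∑ j, Complex.normSq
      (((hA.eigenvectorUnitary : Matrix n n ℂ)ᴴ * C) j i) * f (hA.eigenvalues j) := by
  rw [mfun_of_isHermitian hA]
  set V := (hA.eigenvectorUnitary : Matrix n n ℂ)
  have h : Cᴴ * (V * diagonal (fun i => (f (hA.eigenvalues i) : ℂ)) * Vᴴ) * C =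
      (Vᴴ * C)ᴴ * diagonal (fun i => (f (hA.eigenvalues i) : ℂ)) * (Vᴴ * C) := by
    simp only [conjTranspose_mul, conjTranspose_conjTranspose, Matrix.mul_assoc]
  rw [h, Matrix.mul_apply, Complex.re_sum]
  refine Finset.sum_congr rfl fun j _ => ?_
  rw [mul_diagonal, conjTranspose_apply, mul_right_comm, Complex.star_def,
    ← Complex.normSq_eq_conj_mul_self, ← Complex.ofReal_mul, Complex.ofReal_re]

/-- Jensen's trace inequality for the power `p ≥ 1` and a contraction `C`, on diagonal entries. -/
lemma conj_mfun_apply_re_rpow_le (hA : A.IsHermitian) {f : ℝ → ℝ}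
    (hf : ∀ i, 0 ≤ f (hA.eigenvalues i)) {p : ℝ} (hp : 1 ≤ p) (C : Matrix n n ℂ) (i : n)
    (hC : ((Cᴴ * C) i i).re ≤ 1) :
    ((Cᴴ * mfun f A * C) i i).re ^ p ≤ ((Cᴴ * mfun (fun x => f x ^ p) A * C) i i).re := by
  have hp0 : 0 < p := by linarith
  have hw : ∑ j, Complex.normSq (((hA.eigenvectorUnitary : Matrix n n ℂ)ᴴ * C) j i) ≤ 1 := by
    have h := conj_mfun_apply_re hA (fun _ => 1) C i
    rw [mfun_const_one hA, Matrix.mul_one] at h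
    simp only [mul_one] at h
    rwa [← h]
  rw [conj_mfun_apply_re hA, conj_mfun_apply_re hA]
  set w := fun j => Complex.normSq (((hA.eigenvectorUnitary : Matrix n n ℂ)ᴴ * C) j i)
  have hw0 : ∀ j, 0 ≤ w j := fun j => Complex.normSq_nonneg _
  have hS0 : 0 ≤ ∑ j, w j * f (hA.eigenvalues j) ^ p :=
    Finset.sum_nonneg fun j _ => mul_nonneg (hw0 j) (Real.rpow_nonneg (hf j) _)
  have hle : ∑ j, w j * f (hA.eigenvalues j) ≤
      (∑ j, w j * f (hA.eigenvalues j) ^ p) ^ p⁻¹ := by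
    refine (Real.inner_le_weight_mul_Lp_of_nonneg Finset.univ hp w _ hw0 hf).trans ?_
    refine mul_le_of_le_one_left (Real.rpow_nonneg hS0 _) ?_
    refine Real.rpow_le_one (Finset.sum_nonneg fun j _ => hw0 j) hw ?_
    linarith [inv_le_one_of_one_le₀ hp]
  calc (∑ j, w j * f (hA.eigenvalues j)) ^ p
      ≤ ((∑ j, w j * f (hA.eigenvalues j) ^ p) ^ p⁻¹) ^ p :=
        Real.rpow_le_rpow (Finset.sum_nonneg fun j _ => mul_nonneg (hw0 j) (hf j)) hle hp0.le
    _ = _ := Real.rpow_inv_rpow hS0 hp0.ne'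

lemma sum_conj_mfun_apply_re_rpow_le (hA : A.IsHermitian) {f : ℝ → ℝ}
    (hf : ∀ i, 0 ≤ f (hA.eigenvalues i)) {p : ℝ} (hp : 1 ≤ p) (C : Matrix n n ℂ)
    (hC : ∀ i, ((Cᴴ * C) i i).re ≤ 1) :
    ∑ i, ((Cᴴ * mfun f A * C) i i).re ^ p ≤
      (Cᴴ * mfun (fun x => f x ^ p) A * C).trace.re := by
  rw [Matrix.trace, Complex.re_sum]
  exact Finset.sum_le_sum fun i _ => conj_mfun_apply_re_rpow_le hA hf hp C i (hC i)

lemma sum_conj_unitary_apply_re_rpow_le (hA : A.PosSemidef) {p : ℝ} (hp : 1 ≤ p)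
    {F : Matrix n n ℂ} (hF : Fᴴ * F = 1) :
    ∑ i, ((Fᴴ * A * F) i i).re ^ p ≤ (mfun (fun x => x ^ p) A).trace.re := by
  have h := sum_conj_mfun_apply_re_rpow_le hA.1 (f := fun x => x) hA.eigenvalues_nonneg hp F
    (by simp [hF])
  rwa [mfun_id hA.1, trace_mul_comm, ← Matrix.mul_assoc, mul_eq_one_comm.mp hF,
    Matrix.one_mul] at h

end FunctionalCalculus

section Power

variable {n : Type*} [Fintype n] [DecidableEq n] {A : Matrix n n ℂ}

lemma mpow_mul_mpow (hA : A.PosSemidef) (r s : ℝ) : mpow A r * mpow A s = mpow A (r + s) := by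
  rw [mpow, mpow, mfun_mul hA.1]
  refine mfun_congr hA.1 fun i => ?_
  by_cases h : hA.1.eigenvalues i = 0
  · simp [h]
  · have hpos : 0 < hA.1.eigenvalues i := lt_of_le_of_ne (hA.eigenvalues_nonneg i) (Ne.symm h)
    simp only [h, if_false, Real.rpow_eq_pow]
    rw [Real.rpow_add hpos]

lemma mpow_one (hA : A.PosSemidef) : mpow A 1 = A := by
  conv_rhs => rw [← mfun_id hA.1]
  refine mfun_congr hA.1 fun i => ?_
  by_cases h : hA.1.eigenvalues i = 0 <;> simp [h]

lemma mul_mpow_zero (hA : A.PosSemidef) : A * mpow A 0 = A := by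
  nth_rewrite 1 [← mpow_one hA]
  rw [mpow_mul_mpow hA, add_zero, mpow_one hA]

/-- `mpow A 0` is the support projection of `A`. -/
lemma mul_mpow_zero_of_suppLE (hA : A.PosSemidef) {T : Matrix n n ℂ} (h : suppLE T A) :
    T * mpow A 0 = T := by
  refine (Matrix.ext_of_mulVec_single fun i => ?_)
  have hz : A *ᵥ ((1 - mpow A 0) *ᵥ Pi.single i 1) = 0 := by
    rw [mulVec_mulVec, Matrix.mul_sub, mul_mpow_zero hA, Matrix.mul_one, sub_self, zero_mulVec]
  have hT := h _ hz
  rw [mulVec_mulVec, Matrix.mul_sub, Matrix.mul_one, sub_mulVec, sub_eq_zero] at hT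
  exact hT.symm

/-- An Araki–Lieb–Thirring type inequality for an effect `L`. -/
lemma trace_mfun_rpow_sandwich_le (hA : A.PosSemidef) {L : Matrix n n ℂ} (hL : L.PosSemidef)
    (hL1 : (1 - L).PosSemidef) {p : ℝ} (hp : 1 ≤ p) {s : ℝ} (hs : 2 * s * p = 1) :
    (mfun (fun x => x ^ p) (mpow A s * L * mpow A s)).trace.re ≤ (L * A).trace.re := by
  have hp0 : 0 < p := by linarith
  set K := mpow L (1 / 2) with hK
  have hKh : Kᴴ = K := mfun_isHermitian _ _
  have hSh : (mpow A s)ᴴ = mpow A s := mfun_isHermitian _ _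
  have hKK : K * K = L := by
    rw [hK, mpow_mul_mpow hL]
    norm_num [mpow_one hL]
  have e1 : mpow A s * L * mpow A s = (K * mpow A s)ᴴ * (K * mpow A s) := by
    rw [conjTranspose_mul, hKh, hSh, ← hKK]
    simp only [Matrix.mul_assoc]
  have e2 : (K * mpow A s) * (K * mpow A s)ᴴ = K * mpow A (2 * s) * K := by
    rw [conjTranspose_mul, hKh, hSh, two_mul, ← mpow_mul_mpow hA]
    simp only [Matrix.mul_assoc]
  rw [e1, trace_mfun_conjTranspose_mul_self, e2]
  have hB : (K * mpow A (2 * s) * K).IsHermitian := by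
    rw [← e2]
    exact isHermitian_mul_conjTranspose_self _
  set G := (hB.eigenvectorUnitary : Matrix n n ℂ) with hG
  have hGG : Gᴴ * G = 1 := conjTranspose_eigenvectorUnitary_mul_self hB
  have hGG' : G * Gᴴ = 1 := eigenvectorUnitary_mul_conjTranspose_self hB
  have hdiag : (K * G)ᴴ * mpow A (2 * s) * (K * G) =
      diagonal (fun i => (hB.eigenvalues i : ℂ)) := by
    have h := mfun_id hB
    rw [mfun_of_isHermitian hB] at h
    calc _ = Gᴴ * (K * mpow A (2 * s) * K) * G := by
          rw [conjTranspose_mul, hKh]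
          simp only [Matrix.mul_assoc]
      _ = (Gᴴ * G) * diagonal (fun i => (hB.eigenvalues i : ℂ)) * (Gᴴ * G) := by
          conv_lhs => rw [← h]
          simp only [Matrix.mul_assoc, hG]
      _ = _ := by rw [hGG, Matrix.one_mul, Matrix.mul_one]
  have hcontr : ∀ i, (((K * G)ᴴ * (K * G)) i i).re ≤ 1 := by
    intro i
    have h := (Complex.le_def.mp ((hL1.conjTranspose_mul_mul_same G).diag_nonneg (i := i))).1
    have h' : Gᴴ * (1 - L) * G = 1 - (K * G)ᴴ * (K * G) := by
      rw [conjTranspose_mul, hKh, Matrix.mul_sub, Matrix.sub_mul, Matrix.mul_one, hGG, ← hKK]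
      simp only [Matrix.mul_assoc]
    rw [h'] at h
    simpa using h
  have hnn : ∀ i, 0 ≤ (if hA.1.eigenvalues i = 0 then 0
      else Real.rpow (hA.1.eigenvalues i) (2 * s)) := fun i => by
    split_ifs
    · exact le_rfl
    · exact Real.rpow_nonneg (hA.eigenvalues_nonneg i) _
  have hJ := sum_conj_mfun_apply_re_rpow_le hA.1
    (f := fun x => if x = 0 then 0 else Real.rpow x (2 * s)) hnn hp (K * G) hcontr
  have hpow : mfun (fun x => (if x = 0 then 0 else Real.rpow x (2 * s)) ^ p) A = A := by
    conv_rhs => rw [← mfun_id hA.1]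
    refine mfun_congr hA.1 fun i => ?_
    by_cases h : hA.1.eigenvalues i = 0
    · simp [h, Real.zero_rpow hp0.ne']
    · rw [if_neg h, Real.rpow_eq_pow, ← Real.rpow_mul (hA.eigenvalues_nonneg i), hs,
        Real.rpow_one]
  rw [hpow, ← mpow, hdiag] at hJ
  rw [trace_mfun hB]
  refine (le_of_eq ?_).trans (hJ.trans (le_of_eq ?_))
  · simp
  · congr 1
    calc _ = ((K * A * K) * (G * Gᴴ)).trace := by
          rw [conjTranspose_mul, hKh, ← Matrix.mul_assoc, trace_mul_comm]
          simp only [Matrix.mul_assoc]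
          rw [trace_mul_comm]
          simp only [Matrix.mul_assoc]
          rw [trace_mul_comm]
          simp only [Matrix.mul_assoc]
      _ = _ := by
          rw [hGG', Matrix.mul_one, Matrix.mul_assoc, trace_mul_comm, Matrix.mul_assoc, hKK,
            trace_mul_comm]

/-- Hölder's inequality for the trace pairing of a positive semidefinite and a Hermitian matrix. -/
lemma trace_mul_le_Lp_mul_schattenPow (hA : A.PosSemidef) {X : Matrix n n ℂ}
    (hX : X.IsHermitian) {p q : ℝ} (hpq : p.HolderConjugate q) :
    (A * X).trace.re ≤
      (mfun (fun x => x ^ p) A).trace.re ^ (1 / p) * schattenPow q X ^ (1 / q) := by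
  set F := (hX.eigenvectorUnitary : Matrix n n ℂ) with hF
  have hFF : Fᴴ * F = 1 := conjTranspose_eigenvectorUnitary_mul_self hX
  have hd0 : ∀ i, 0 ≤ ((Fᴴ * A * F) i i).re := fun i =>
    (Complex.le_def.mp ((hA.conjTranspose_mul_mul_same F).diag_nonneg (i := i))).1
  have htr : (A * X).trace.re = ∑ i, ((Fᴴ * A * F) i i).re * hX.eigenvalues i := by
    have h : (A * X).trace =
        (Fᴴ * A * F * diagonal (fun i => (hX.eigenvalues i : ℂ))).trace := by
      conv_lhs => rw [← mfun_id hX, mfun_of_isHermitian hX, ← Matrix.mul_assoc, trace_mul_comm]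
      simp only [Matrix.mul_assoc, hF]
    rw [h, Matrix.trace, Complex.re_sum]
    refine Finset.sum_congr rfl fun i _ => ?_
    rw [diag_apply, mul_diagonal, Complex.re_mul_ofReal]
  rw [htr, schattenPow_of_isHermitian hpq.symm.pos hX]
  refine (Real.inner_le_Lp_mul_Lq Finset.univ _ _ hpq).trans ?_
  refine mul_le_mul_of_nonneg_right ?_ (Real.rpow_nonneg
    (Finset.sum_nonneg fun i _ => Real.rpow_nonneg (abs_nonneg _) _) _)
  refine Real.rpow_le_rpow (Finset.sum_nonneg fun i _ => Real.rpow_nonneg (abs_nonneg _) _) ?_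
    (one_div_nonneg.mpr hpq.pos.le)
  simp only [abs_of_nonneg (hd0 _)]
  exact sum_conj_unitary_apply_re_rpow_le hA hpq.lt.le hFF

lemma schattenPow_nonneg {q : ℝ} (hq : 0 < q) {X : Matrix n n ℂ} (hX : X.IsHermitian) :
    0 ≤ schattenPow q X := by
  rw [schattenPow_of_isHermitian hq hX]
  exact Finset.sum_nonneg fun i _ => Real.rpow_nonneg (abs_nonneg _) _

lemma sandwich_isHermitian {T : Matrix n n ℂ} (hT : T.IsHermitian) (r : ℝ) :
    (mpow A r * T * mpow A r).IsHermitian := by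
  have h := isHermitian_mul_mul_conjTranspose (mpow A r) hT
  rwa [show (mpow A r)ᴴ = mpow A r from mfun_isHermitian _ _] at h

/-- The trace pairing with an effect is bounded by the sandwiched Rényi quasi-divergence. -/
lemma trace_mul_le_sandQ (hA : A.PosSemidef) {T L : Matrix n n ℂ} (hT : T.IsHermitian)
    (hsupp : suppLE T A) (hL : L.PosSemidef) (hL1 : (1 - L).PosSemidef) {α : ℝ} (hα : 1 < α) :
    (L * T).trace.re ≤ (L * A).trace.re ^ ((α - 1) / α) * sandQ α T A ^ (1 / α) := by
  have hα0 : 0 < α := by linarith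
  have hα1 : 0 < α - 1 := by linarith
  set r := (1 - α) / (2 * α) with hr
  have hpq : (α / (α - 1)).HolderConjugate α := by
    rw [Real.holderConjugate_iff]
    refine ⟨(one_lt_div hα1).mpr (by linarith), ?_⟩
    field_simp
    ring
  have hs : 2 * (-r) * (α / (α - 1)) = 1 := by
    rw [hr]
    field_simp
    ring
  have hP : T * mpow A 0 = T := mul_mpow_zero_of_suppLE hA hsupp
  have hP' : mpow A 0 * T = T := by
    have h := congrArg conjTranspose hP
    rwa [conjTranspose_mul, hT.eq, show (mpow A 0)ᴴ = mpow A 0 from mfun_isHermitian _ _] at h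
  have hTX : mpow A (-r) * (mpow A r * T * mpow A r) * mpow A (-r) = T := by
    calc _ = (mpow A (-r) * mpow A r) * T * (mpow A r * mpow A (-r)) := by
          simp only [Matrix.mul_assoc]
      _ = T := by
          rw [mpow_mul_mpow hA, mpow_mul_mpow hA, neg_add_cancel, add_neg_cancel, hP', hP]
  have htr : (L * T).trace =
      ((mpow A (-r) * L * mpow A (-r)) * (mpow A r * T * mpow A r)).trace := by
    conv_lhs => rw [← hTX, ← Matrix.mul_assoc, trace_mul_comm]
    simp only [Matrix.mul_assoc]
  have hLs : (mpow A (-r) * L * mpow A (-r)).PosSemidef := by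
    have h := hL.mul_mul_conjTranspose_same (mpow A (-r))
    rwa [show (mpow A (-r))ᴴ = mpow A (-r) from mfun_isHermitian _ _] at h
  have hX := sandwich_isHermitian (A := A) hT r
  rw [htr, ← one_div_div α (α - 1)]
  refine (trace_mul_le_Lp_mul_schattenPow hLs hX hpq).trans ?_
  refine mul_le_mul_of_nonneg_right ?_ (Real.rpow_nonneg (schattenPow_nonneg hα0 hX) _)
  refine Real.rpow_le_rpow ?_ (trace_mfun_rpow_sandwich_le hA hL hL1 hpq.lt.le hs)
    (one_div_nonneg.mpr hpq.pos.le)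
  rw [trace_mfun hLs.1]
  exact Finset.sum_nonneg fun i _ => Real.rpow_nonneg (hLs.eigenvalues_nonneg i) _

lemma trace_mul_re_nonneg (hA : A.PosSemidef) {L : Matrix n n ℂ} (hL : L.PosSemidef) :
    0 ≤ (L * A).trace.re := by
  have hS : (mpow A (1 / 2))ᴴ = mpow A (1 / 2) := mfun_isHermitian _ _
  have hSS : mpow A (1 / 2) * mpow A (1 / 2) = A := by
    rw [mpow_mul_mpow hA]
    norm_num [mpow_one hA]
  have h := (Complex.le_def.mp (hL.mul_mul_conjTranspose_same (mpow A (1 / 2))).trace_nonneg).1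
  rwa [hS, trace_mul_comm, ← Matrix.mul_assoc, hSS, trace_mul_comm] at h

end Power

/-- Taking logarithms in a Hölder-type bound `1 - ε ≤ t ^ ((α - 1) / α) * Q ^ (1 / α)`. -/
lemma neg_log_le_of_le_rpow_mul_rpow {ε α t Q : ℝ} (hε : ε < 1) (hα : 1 < α) (ht : 0 < t)
    (hQ : 0 < Q) (h : 1 - ε ≤ t ^ ((α - 1) / α) * Q ^ (1 / α)) :
    -Real.log t ≤ 1 / (α - 1) * Real.log Q + α / (α - 1) * Real.log (1 / (1 - ε)) := by
  have hα0 : 0 < α := by linarith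
  have hα1 : 0 < α - 1 := by linarith
  have hlog := Real.log_le_log (by linarith) h
  rw [Real.log_mul (Real.rpow_pos_of_pos ht _).ne' (Real.rpow_pos_of_pos hQ _).ne',
    Real.log_rpow ht, Real.log_rpow hQ] at hlog
  have hmul := mul_le_mul_of_nonneg_left hlog (div_pos hα0 hα1).le
  have e : α / (α - 1) * ((α - 1) / α * Real.log t + 1 / α * Real.log Q) =
      Real.log t + 1 / (α - 1) * Real.log Q := by
    field_simp
  rw [e] at hmul
  rw [one_div (1 - ε), Real.log_inv]
  linarith

/-- the extended hypothesis-testing divergence is bounded by the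
extended sandwiched Rényi divergence. -/
theorem extended_hypothesis_testing_le_sandwiched
    {n : Type} [Fintype n] [DecidableEq n]
    (τ σ : Matrix n n ℂ) (hτ : UnitTraceHerm τ) (hσ : σ.PosSemidef)
    (ε α : ℝ) (hε0 : 0 ≤ ε) (hε1 : ε < 1) (hα : 1 < α) :
    DH ε τ σ ≤ sandD α τ σ + (((α / (α - 1)) * Real.log (1 / (1 - ε)) : ℝ) : EReal) := by
  refine iSup₂_le fun Λ hΛ => ?_
  obtain ⟨hΛ0, hΛ1, hΛτ⟩ := hΛ
  rw [sandD]
  split_ifs with hsupp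
  · have hα0 : 0 < α := by linarith
    have hα1 : 0 < α - 1 := by linarith
    have hle := hΛτ.trans (trace_mul_le_sandQ hσ hτ.1 hsupp hΛ0 hΛ1 hα)
    have ht0 : 0 ≤ (Λ * σ).trace.re := trace_mul_re_nonneg hσ hΛ0
    have hQ0 : 0 ≤ sandQ α τ σ := schattenPow_nonneg hα0 (sandwich_isHermitian hτ.1 _)
    have ht : 0 < (Λ * σ).trace.re := by
      refine lt_of_le_of_ne ht0 fun h => ?_
      rw [← h, Real.zero_rpow (div_pos hα1 hα0).ne', zero_mul] at hle
      linarith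
    have hQ : 0 < sandQ α τ σ := by
      refine lt_of_le_of_ne hQ0 fun h => ?_
      rw [← h, Real.zero_rpow (one_div_pos.mpr hα0).ne', mul_zero] at hle
      linarith
    rw [negLogE, if_neg (not_le.mpr ht), ← EReal.coe_add, EReal.coe_le_coe_iff, sandDR]
    exact neg_log_le_of_le_rpow_mul_rpow hε1 hα ht hQ hle
  · rw [EReal.top_add_coe]
    exact le_top

end QHE
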